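/- Suppose F and O are nonempty and p_max ≥ q_max. Then for every ε > 0 there exists a feasible schedule π such that makespan(π) < (1+ε)·makespan(σ) for every feasible schedule σ; moreover π can be chosen so that either its makespan equals 2·p_max + P(F), or its makespan equals P(F) + Q(O), or its makespan equals P(F) + Q(O) + p_max − Q(B) for some B ⊆ O with Q(B) ≤ p_max. -/

import Mathlib

open Finset

noncomputable section

/-- Processing time of a job: `p` on flow-shop jobs, `q` otherwise. -/
def jobTime {J : Type*} [DecidableEq J] (F : Finset J) (p q : J → ℝ) (j : J) : ℝ :=
  if j ∈ F then p j else q j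

/-- Feasibility of a schedule given by start times `S j i` of job `j` on machine `i`
(machines `M1, M2, M3` are machines `0, 1, 2`):
all start times are nonnegative, on each machine the open processing intervals of
distinct jobs are pairwise disjoint, for each job the open processing intervals on the
three machines are pairwise disjoint, and each flow-shop job goes through
`M1`, `M2`, `M3` in this order. -/
def Feasible {J : Type*} [DecidableEq J] (F O : Finset J) (p q : J → ℝ)
    (S : J → Fin 3 → ℝ) : Prop :=
  (∀ j ∈ F ∪ O, ∀ i : Fin 3, 0 ≤ S j i) ∧
  (∀ i : Fin 3, ∀ j ∈ F ∪ O, ∀ k ∈ F ∪ O, j ≠ k →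
    S j i + jobTime F p q j ≤ S k i ∨ S k i + jobTime F p q k ≤ S j i) ∧
  (∀ j ∈ F ∪ O, ∀ i i' : Fin 3, i ≠ i' →
    S j i + jobTime F p q j ≤ S j i' ∨ S j i' + jobTime F p q j ≤ S j i) ∧
  (∀ j ∈ F, S j 0 + p j ≤ S j 1 ∧ S j 1 + p j ≤ S j 2)

/-- Makespan: supremum of all completion times of the jobs of `F ∪ O`. -/
def makespan {J : Type*} [DecidableEq J] (F O : Finset J) (p q : J → ℝ)
    (S : J → Fin 3 → ℝ) : ℝ :=
  sSup {x : ℝ | ∃ j ∈ F ∪ O, ∃ i : Fin 3, x = S j i + jobTime F p q j}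

/-- Sequencing a finite set of jobs without idle time. -/
theorem exists_sequence {J : Type*} [DecidableEq J] (t : J → ℝ) (T : Finset J)
    (ht : ∀ j ∈ T, 0 < t j) :
    ∃ f : J → ℝ, (∀ j ∈ T, 0 ≤ f j ∧ f j + t j ≤ ∑ k ∈ T, t k) ∧
      ∀ j ∈ T, ∀ k ∈ T, j ≠ k → f j + t j ≤ f k ∨ f k + t k ≤ f j := by
  induction T using Finset.induction_on with
  | empty => exact ⟨fun _ => 0, by simp, by simp⟩
  | insert x T hx ih =>
    obtain ⟨f, h1, h2⟩ := ih (fun j hj => ht j (mem_insert_of_mem hj))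
    have htx := ht x (mem_insert_self _ _)
    have hne : ∀ j ∈ T, j ≠ x := fun j hj h => hx (h ▸ hj)
    have hnn : 0 ≤ ∑ k ∈ T, t k :=
      sum_nonneg (fun j hj => (ht j (mem_insert_of_mem hj)).le)
    refine ⟨fun j => if j = x then ∑ k ∈ T, t k else f j, ?_, ?_⟩
    · intro j hj
      rw [sum_insert hx]
      rcases mem_insert.1 hj with rfl | hj
      · simp only [if_true]; constructor <;> linarith
      · have := h1 j hj
        simp only [hne j hj, if_false]; constructor <;> linarith
    · intro j hj k hk hjk
      rcases mem_insert.1 hj with rfl | hj' <;> rcases mem_insert.1 hk with rfl | hk'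
      · exact absurd rfl hjk
      · simp only [if_true, hne k hk', if_false]
        exact Or.inr (h1 k hk').2
      · simp only [if_true, hne j hj', if_false]
        exact Or.inl (h1 j hj').2
      · simp only [hne j hj', hne k hk', if_false]
        exact h2 j hj' k hk' hjk

/-- Disjoint intervals inside `[l, r]` have total length at most `r - l`. -/
theorem packing {J : Type*} [DecidableEq J] (t s : J → ℝ) (T : Finset J) (l : ℝ)
    (ht : ∀ j ∈ T, 0 < t j)
    (hd : ∀ j ∈ T, ∀ k ∈ T, j ≠ k → s j + t j ≤ s k ∨ s k + t k ≤ s j)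
    (hl : ∀ j ∈ T, l ≤ s j) :
    ∀ r, l ≤ r → (∀ j ∈ T, s j + t j ≤ r) → l + ∑ j ∈ T, t j ≤ r := by
  induction T using Finset.induction_on_max_value (fun j => s j + t j) with
  | empty => intro r h _; simpa using h
  | insert x T hx hmax ih =>
    intro r _ hr
    have h := ih (fun j hj => ht j (mem_insert_of_mem hj))
      (fun j hj k hk => hd j (mem_insert_of_mem hj) k (mem_insert_of_mem hk))
      (fun j hj => hl j (mem_insert_of_mem hj)) (s x) (hl x (mem_insert_self _ _)) (by
        intro j hj
        have h1 := hmax j hj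
        have h2 := ht j (mem_insert_of_mem hj)
        rcases hd j (mem_insert_of_mem hj) x (mem_insert_self _ _)
          (fun h => hx (h ▸ hj)) with h | h
        · exact h
        · linarith)
    have := hr x (mem_insert_self _ _)
    rw [sum_insert hx]
    linarith

theorem completion_le_makespan {J : Type*} [DecidableEq J] (F O : Finset J) (p q : J → ℝ)
    (S : J → Fin 3 → ℝ) (j : J) (hj : j ∈ F ∪ O) (i : Fin 3) :
    S j i + jobTime F p q j ≤ makespan F O p q S := by
  apply le_csSup
  · apply Set.Finite.bddAbove
    apply Set.Finite.subset
      (((F ∪ O) ×ˢ (Finset.univ : Finset (Fin 3))).image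
        (fun x => S x.1 x.2 + jobTime F p q x.1)).finite_toSet
    rintro x ⟨j, hj, i, rfl⟩
    simp only [coe_image, Set.mem_image, Finset.mem_coe, mem_product]
    exact ⟨(j, i), ⟨hj, mem_univ _⟩, rfl⟩
  · exact ⟨j, hj, i, rfl⟩

/-- The lower bound obtained by looking at the longest flow-shop job on the second machine. -/
theorem lower_bound {J : Type*} [DecidableEq J] (F O : Finset J) (p q : J → ℝ)
    (hdisj : Disjoint F O)
    (hp : ∀ j ∈ F, 0 < p j) (hq : ∀ j ∈ O, 0 < q j) (A : J) (hA : A ∈ F)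
    (S : J → Fin 3 → ℝ) (hS : Feasible F O p q S) :
    ∃ B ⊆ O, (∑ j ∈ F, p j) + max (p A) (∑ j ∈ B, q j) + max (p A) (∑ j ∈ O \ B, q j)
      ≤ makespan F O p q S := by
  obtain ⟨h0, hm, -, hf⟩ := hS
  set C := makespan F O p q S with hC
  have hle : ∀ j ∈ F ∪ O, ∀ i, S j i + jobTime F p q j ≤ C :=
    fun j hj i => completion_le_makespan F O p q S j hj i
  set t := jobTime F p q with ht
  have htF : ∀ j ∈ F, t j = p j := fun j hj => by simp [ht, jobTime, hj]
  have htO : ∀ j ∈ O, t j = q j := fun j hj => by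
    have : j ∉ F := fun h => (Finset.disjoint_left.1 hdisj h hj)
    simp [ht, jobTime, this]
  have htpos : ∀ j ∈ F ∪ O, 0 < t j := by
    intro j hj
    rcases mem_union.1 hj with h | h
    · rw [htF j h]; exact hp j h
    · rw [htO j h]; exact hq j h
  have hFu : ∀ j ∈ F, j ∈ F ∪ O := fun j hj => mem_union_left _ hj
  have hOu : ∀ j ∈ O, j ∈ F ∪ O := fun j hj => mem_union_right _ hj
  have hpack : ∀ (i : Fin 3) (T : Finset J) (l r : ℝ), T ⊆ F ∪ O → l ≤ r →
      (∀ j ∈ T, l ≤ S j i) → (∀ j ∈ T, S j i + t j ≤ r) → l + ∑ j ∈ T, t j ≤ r := by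
    intro i T l r hT hlr h1 h2
    exact packing t (fun j => S j i) T l (fun j hj => htpos j (hT hj))
      (fun j hj k hk hjk => hm i j (hT hj) k (hT hk) hjk) h1 r hlr h2
  -- jobs other than `A`, split by position relative to `A` on the second machine
  let X := (F.erase A).filter (fun j => S j 1 + t j ≤ S A 1)
  let Y := (F.erase A).filter (fun j => ¬ S j 1 + t j ≤ S A 1)
  let B := O.filter (fun j => S j 1 + t j ≤ S A 1)
  have hBc : O \ B = O.filter (fun j => ¬ S j 1 + t j ≤ S A 1) := by
    ext j; simp only [B, mem_sdiff, mem_filter]; tauto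
  have hXF : ∀ j ∈ X, j ∈ F ∧ j ≠ A ∧ S j 1 + t j ≤ S A 1 := by
    intro j hj; simp only [X, mem_filter, mem_erase] at hj; tauto
  have hYF : ∀ j ∈ Y, j ∈ F ∧ j ≠ A ∧ S A 1 + t A ≤ S j 1 := by
    intro j hj
    simp only [Y, mem_filter, mem_erase] at hj
    refine ⟨hj.1.2, hj.1.1, ?_⟩
    exact (hm 1 j (hFu j hj.1.2) A (hFu A hA) hj.1.1).resolve_left hj.2
  have hBO : ∀ j ∈ B, j ∈ O ∧ S j 1 + t j ≤ S A 1 := by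
    intro j hj; simpa only [B, mem_filter] using hj
  have hCO : ∀ j ∈ O \ B, j ∈ O ∧ S A 1 + t A ≤ S j 1 := by
    intro j hj
    rw [hBc, mem_filter] at hj
    refine ⟨hj.1, ?_⟩
    have hne : j ≠ A := fun h => Finset.disjoint_left.1 hdisj hA (h ▸ hj.1)
    exact (hm 1 j (hOu j hj.1) A (hFu A hA) hne).resolve_left hj.2
  have hsum : ∑ j ∈ X, t j + ∑ j ∈ Y, t j + t A = ∑ j ∈ F, p j := by
    rw [← sum_congr rfl htF, ← sum_erase_add F t hA]
    congr 1
    exact sum_filter_add_sum_filter_not _ _ _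
  have hAX : A ∉ X := fun h => (hXF A h).2.1 rfl
  have hAY : A ∉ Y := fun h => (hYF A h).2.1 rfl
  have hXB : Disjoint X B := by
    rw [Finset.disjoint_left]
    exact fun j h1 h2 => Finset.disjoint_left.1 hdisj (hXF j h1).1 (hBO j h2).1
  have hYC : Disjoint Y (O \ B) := by
    rw [Finset.disjoint_left]
    exact fun j h1 h2 => Finset.disjoint_left.1 hdisj (hYF j h1).1 (hCO j h2).1
  have hA0 := h0 A (hFu A hA) 1
  have hAC := hle A (hFu A hA) 1
  have e1 : 0 + ∑ j ∈ insert A X, t j ≤ S A 1 := by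
    apply hpack 0 _ 0 _ _ hA0
    · intro j hj
      rcases mem_insert.1 hj with rfl | hj
      · exact h0 _ (hFu _ hA) 0
      · exact h0 _ (hFu _ (hXF j hj).1) 0
    · intro j hj
      rcases mem_insert.1 hj with rfl | hj
      · rw [htF _ hA]; exact (hf _ hA).1
      · obtain ⟨h1, -, h3⟩ := hXF j hj
        have := (hf j h1).1
        have := htpos j (hFu j h1)
        have := htF j h1
        linarith
    · intro j hj
      rcases mem_insert.1 hj with rfl | hj
      · exact hFu _ hA
      · exact hFu _ (hXF j hj).1
  have e2 : 0 + ∑ j ∈ X ∪ B, t j ≤ S A 1 := by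
    have hsub : X ∪ B ⊆ F ∪ O := by
      intro j hj
      rcases mem_union.1 hj with hj | hj
      · exact hFu _ (hXF j hj).1
      · exact hOu _ (hBO j hj).1
    apply hpack 1 _ 0 _ hsub hA0
    · exact fun j hj => h0 j (hsub hj) 1
    · intro j hj
      rcases mem_union.1 hj with hj | hj
      · exact (hXF j hj).2.2
      · exact (hBO j hj).2
  have e3 : (S A 1 + t A) + ∑ j ∈ insert A Y, t j ≤ C := by
    have hsub : insert A Y ⊆ F ∪ O := by
      intro j hj
      rcases mem_insert.1 hj with rfl | hj
      · exact hFu _ hA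
      · exact hFu _ (hYF j hj).1
    apply hpack 2 _ _ _ hsub hAC
    · intro j hj
      rcases mem_insert.1 hj with rfl | hj
      · rw [htF _ hA]; exact (hf _ hA).2
      · obtain ⟨h1, -, h3⟩ := hYF j hj
        have := (hf j h1).2
        have := htpos j (hFu j h1)
        have := htF j h1
        linarith
    · exact fun j hj => hle j (hsub hj) 2
  have e4 : (S A 1 + t A) + ∑ j ∈ Y ∪ (O \ B), t j ≤ C := by
    have hsub : Y ∪ (O \ B) ⊆ F ∪ O := by
      intro j hj
      rcases mem_union.1 hj with hj | hj
      · exact hFu _ (hYF j hj).1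
      · exact hOu _ (hCO j hj).1
    apply hpack 1 _ _ _ hsub hAC
    · intro j hj
      rcases mem_union.1 hj with hj | hj
      · exact (hYF j hj).2.2
      · exact (hCO j hj).2
    · exact fun j hj => hle j (hsub hj) 1
  rw [sum_insert hAX] at e1
  rw [sum_insert hAY] at e3
  rw [sum_union hXB] at e2
  rw [sum_union hYC] at e4
  rw [sum_congr rfl (fun j hj => htO j (hBO j hj).1)] at e2
  rw [sum_congr rfl (fun j hj => htO j (hCO j hj).1)] at e4
  have hAA := htF A hA
  refine ⟨B, filter_subset _ _, ?_⟩
  rcases max_cases (p A) (∑ j ∈ B, q j) with ⟨h, -⟩ | ⟨h, -⟩ <;>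
  rcases max_cases (p A) (∑ j ∈ O \ B, q j) with ⟨h', -⟩ | ⟨h', -⟩ <;>
  rw [h, h'] <;> linarith

/-- The schedule associated with a splitting of the open-shop jobs. -/
theorem upper_bound {J : Type*} [DecidableEq J] (F O : Finset J) (p q : J → ℝ)
    (hdisj : Disjoint F O)
    (hp : ∀ j ∈ F, 0 < p j) (hq : ∀ j ∈ O, 0 < q j) (A : J) (hA : A ∈ F)
    (hpA : ∀ j ∈ F, p j ≤ p A) (hqA : ∀ j ∈ O, q j ≤ p A) (B : Finset J) (hB : B ⊆ O) :
    ∃ S : J → Fin 3 → ℝ, Feasible F O p q S ∧ makespan F O p q S ≤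
      (∑ j ∈ F, p j) + max (p A) (∑ j ∈ B, q j) + max (p A) (∑ j ∈ O \ B, q j) := by
  obtain ⟨f, f1, f2⟩ := exists_sequence p F hp
  obtain ⟨g, g1, g2⟩ := exists_sequence q B (fun j hj => hq j (hB hj))
  obtain ⟨h, h1, h2⟩ := exists_sequence q (O \ B) (fun j hj => hq j (mem_sdiff.1 hj).1)
  have hAP : p A ≤ ∑ j ∈ F, p j := single_le_sum (fun j hj => (hp j hj).le) hA
  set P := ∑ j ∈ F, p j
  have a1 := le_max_left (p A) (∑ j ∈ B, q j)
  have a2 := le_max_right (p A) (∑ j ∈ B, q j)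
  have b1 := le_max_left (p A) (∑ j ∈ O \ B, q j)
  have b2 := le_max_right (p A) (∑ j ∈ O \ B, q j)
  set a := max (p A) (∑ j ∈ B, q j)
  set b := max (p A) (∑ j ∈ O \ B, q j)
  set QB := ∑ j ∈ B, q j
  set QC := ∑ j ∈ O \ B, q j
  have hA0 := hp A hA
  let S : J → Fin 3 → ℝ := fun j =>
    if j ∈ F then ![f j, f j + a, f j + (a + b)]
    else if j ∈ B then ![g j + (P + b), g j, g j + b]
    else ![h j + P, h j + (P + a), h j]
  have key : ∀ j ∈ F ∪ O,
      (j ∈ F ∧ jobTime F p q j = p j ∧ S j = ![f j, f j + a, f j + (a + b)]) ∨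
      (j ∈ B ∧ jobTime F p q j = q j ∧ S j = ![g j + (P + b), g j, g j + b]) ∨
      (j ∈ O \ B ∧ jobTime F p q j = q j ∧ S j = ![h j + P, h j + (P + a), h j]) := by
    intro j hj
    by_cases hjF : j ∈ F
    · left; simp [S, jobTime, hjF]
    · have hjO : j ∈ O := (mem_union.1 hj).resolve_left hjF
      by_cases hjB : j ∈ B
      · right; left; simp [S, jobTime, hjF, hjB]
      · right; right; simp [S, jobTime, hjF, hjB, hjO]
  refine ⟨S, ⟨?_, ?_, ?_, ?_⟩, ?_⟩
  · intro j hj i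
    rcases key j hj with ⟨hjm, -, hs⟩ | ⟨hjm, -, hs⟩ | ⟨hjm, -, hs⟩ <;> rw [hs]
    · have := f1 j hjm
      fin_cases i <;> simp <;> linarith
    · have := g1 j hjm
      fin_cases i <;> simp <;> linarith
    · have := h1 j hjm
      fin_cases i <;> simp <;> linarith
  · intro i j hj k hk hjk
    rcases key j hj with ⟨hjm, tj, sj⟩ | ⟨hjm, tj, sj⟩ | ⟨hjm, tj, sj⟩ <;>
    rcases key k hk with ⟨hkm, tk, sk⟩ | ⟨hkm, tk, sk⟩ | ⟨hkm, tk, sk⟩ <;>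
    rw [tj, tk, sj, sk]
    · rcases f2 j hjm k hkm hjk with h | h
      · left; fin_cases i <;> simp <;> linarith
      · right; fin_cases i <;> simp <;> linarith
    · have := f1 j hjm
      have := g1 k hkm
      fin_cases i <;> simp
      · left; linarith
      · right; linarith
      · right; linarith
    · have := f1 j hjm
      have := h1 k hkm
      fin_cases i <;> simp
      · left; linarith
      · left; linarith
      · right; linarith
    · have := f1 k hkm
      have := g1 j hjm
      fin_cases i <;> simp
      · right; linarith
      · left; linarith
      · left; linarith
    · rcases g2 j hjm k hkm hjk with h | h
      · left; fin_cases i <;> simp <;> linarith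
      · right; fin_cases i <;> simp <;> linarith
    · have := g1 j hjm
      have := h1 k hkm
      fin_cases i <;> simp
      · right; linarith
      · left; linarith
      · right; linarith
    · have := f1 k hkm
      have := h1 j hjm
      fin_cases i <;> simp
      · right; linarith
      · right; linarith
      · left; linarith
    · have := g1 k hkm
      have := h1 j hjm
      fin_cases i <;> simp
      · left; linarith
      · right; linarith
      · left; linarith
    · rcases h2 j hjm k hkm hjk with h | h
      · left; fin_cases i <;> simp <;> linarith
      · right; fin_cases i <;> simp <;> linarith
  · intro j hj i i' hii
    rcases key j hj with ⟨hjm, tj, sj⟩ | ⟨hjm, tj, sj⟩ | ⟨hjm, tj, sj⟩ <;> rw [tj, sj]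
    · have := hpA j hjm
      fin_cases i <;> fin_cases i' <;> simp at hii ⊢ <;>
        first | (left; linarith) | (right; linarith)
    · have := hqA j (hB hjm)
      fin_cases i <;> fin_cases i' <;> simp at hii ⊢ <;>
        first | (left; linarith) | (right; linarith)
    · have := hqA j (mem_sdiff.1 hjm).1
      fin_cases i <;> fin_cases i' <;> simp at hii ⊢ <;>
        first | (left; linarith) | (right; linarith)
  · intro j hj
    have hs : S j = ![f j, f j + a, f j + (a + b)] := by simp [S, hj]
    have := hpA j hj
    rw [hs]
    constructor <;> simp <;> linarith
  · apply csSup_le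
    · exact ⟨_, A, mem_union_left _ hA, 0, rfl⟩
    · rintro x ⟨j, hj, i, rfl⟩
      rcases key j hj with ⟨hjm, tj, sj⟩ | ⟨hjm, tj, sj⟩ | ⟨hjm, tj, sj⟩ <;> rw [tj, sj]
      · have := f1 j hjm
        fin_cases i <;> simp <;> linarith
      · have := g1 j hjm
        fin_cases i <;> simp <;> linarith
      · have := h1 j hjm
        fin_cases i <;> simp <;> linarith

/-- Theorem 3.7 (FPTAS, existential form): if `F` and `O` are nonempty and
`p_max ≥ q_max`, then for every `ε > 0` there is a feasible schedule whose makespan is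
within a factor `1 + ε` of every feasible schedule's makespan; moreover it can be chosen
with makespan `2 p_max + P(F)`, or `P(F) + Q(O)`, or `P(F) + Q(O) + p_max − Q(B)` for
some `B ⊆ O` with `Q(B) ≤ p_max`. -/
theorem stmt8 {J : Type*} [DecidableEq J] (F O : Finset J) (p q : J → ℝ)
    (hdisj : Disjoint F O)
    (hp : ∀ j ∈ F, 0 < p j) (hq : ∀ j ∈ O, 0 < q j)
    (hF : F.Nonempty) (hO : O.Nonempty)
    (hpq : O.sup' hO q ≤ F.sup' hF p) :
    ∀ ε : ℝ, 0 < ε →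
      ∃ π : J → Fin 3 → ℝ, Feasible F O p q π ∧
        (∀ σ : J → Fin 3 → ℝ, Feasible F O p q σ →
          makespan F O p q π < (1 + ε) * makespan F O p q σ) ∧
        (makespan F O p q π = 2 * F.sup' hF p + (∑ j ∈ F, p j) ∨
         makespan F O p q π = (∑ j ∈ F, p j) + (∑ j ∈ O, q j) ∨
         ∃ B ⊆ O, (∑ j ∈ B, q j) ≤ F.sup' hF p ∧
           makespan F O p q π
             = (∑ j ∈ F, p j) + (∑ j ∈ O, q j) + F.sup' hF p - ∑ j ∈ B, q j) := by
  intro ε hε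
  obtain ⟨A, hA, hAmax⟩ := exists_mem_eq_sup' hF p
  have hpA : ∀ j ∈ F, p j ≤ p A := fun j hj => hAmax ▸ le_sup' p hj
  have hqA : ∀ j ∈ O, q j ≤ p A := fun j hj =>
    hAmax ▸ (le_sup' q hj).trans hpq
  rw [hAmax]
  obtain ⟨B, hBm, hBmin⟩ := exists_min_image O.powerset
    (fun B => (∑ j ∈ F, p j) + max (p A) (∑ j ∈ B, q j) + max (p A) (∑ j ∈ O \ B, q j))
    ⟨∅, empty_mem_powerset _⟩
  have hB : B ⊆ O := mem_powerset.1 hBm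
  obtain ⟨π, hπ, hub⟩ := upper_bound F O p q hdisj hp hq A hA hpA hqA B hB
  have hlow : ∀ σ : J → Fin 3 → ℝ, Feasible F O p q σ →
      (∑ j ∈ F, p j) + max (p A) (∑ j ∈ B, q j) + max (p A) (∑ j ∈ O \ B, q j)
        ≤ makespan F O p q σ := by
    intro σ hσ
    obtain ⟨B', hB', h⟩ := lower_bound F O p q hdisj hp hq A hA σ hσ
    exact (hBmin B' (mem_powerset.2 hB')).trans h
  have heq := le_antisymm hub (hlow π hπ)
  have hA0 := hp A hA
  have hP : 0 ≤ ∑ j ∈ F, p j := sum_nonneg (fun j hj => (hp j hj).le)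
  have hsplit : ∑ j ∈ O \ B, q j + ∑ j ∈ B, q j = ∑ j ∈ O, q j := sum_sdiff hB
  refine ⟨π, hπ, ?_, ?_⟩
  · intro σ hσ
    have h1 := hlow σ hσ
    have h2 := le_max_left (p A) (∑ j ∈ B, q j)
    have h3 := le_max_left (p A) (∑ j ∈ O \ B, q j)
    have h4 : 0 < makespan F O p q σ := by linarith
    have h5 := mul_pos hε h4
    linarith
  · rw [heq]
    rcases le_total (∑ j ∈ B, q j) (p A) with h | h <;>
    rcases le_total (∑ j ∈ O \ B, q j) (p A) with h' | h'
    · left; rw [max_eq_left h, max_eq_left h']; ring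
    · right; right
      refine ⟨B, hB, h, ?_⟩
      rw [max_eq_left h, max_eq_right h']; linarith
    · right; right
      refine ⟨O \ B, sdiff_subset, h', ?_⟩
      rw [max_eq_right h, max_eq_left h']; linarith
    · right; left
      rw [max_eq_right h, max_eq_right h']; linarith
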